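/- Random variables X_1,…,X_n whose joint distribution possesses the canonical representation with kernels g satisfying A1–A3 are m-dependent (1 ≤ m ≤ n) if and only if the kernels factorize across gaps of length at least m: g_{i_1,…,i_k,i_{k+1},…,i_c}(ξ_{i_1},…,ξ_{i_k},ξ_{i_{k+1}},…,ξ_{i_c}) = g_{i_1,…,i_k}(ξ_{i_1},…,ξ_{i_k}) · g_{i_{k+1},…,i_c}(ξ_{i_{k+1}},…,ξ_{i_c}) for all 1 ≤ i_1 < ⋯ < i_k < i_{k+1} < ⋯ < i_c ≤ n with i_{k+1} − i_k ≥ m, k = 1,…,c−1, c = 2,…,n. -/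

import Mathlib

open MeasureTheory Finset

/-- A function `g` on `ℝⁿ` depends only on the coordinates in `S`
(i.e., it is really a function of the variables `x_i`, `i ∈ S`). -/
def DependsOnlyOn {n : ℕ} (S : Finset (Fin n)) (g : (Fin n → ℝ) → ℝ) : Prop :=
  ∀ x y : Fin n → ℝ, (∀ i ∈ S, x i = y i) → g x = g y

/-- The sum of U-statistics `U_n(x) = Σ_{c=2}^n Σ_{i_1<⋯<i_c} g_{i_1,…,i_c}(x_{i_1},…,x_{i_c})`,
where the kernel for the index set `S = {i_1,…,i_c}` is `g S`. -/
noncomputable def Usum {n : ℕ} (g : Finset (Fin n) → (Fin n → ℝ) → ℝ) (x : Fin n → ℝ) : ℝ :=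
  ∑ S ∈ Finset.univ.filter (fun S : Finset (Fin n) => 2 ≤ S.card), g S x

/-- Conditions A1 (integrability), A2 (degeneracy: zero mean in each argument, a.s. in
the remaining arguments) and A3 (positive definiteness: `U_n ≥ -1` a.s.) for a family of
Borel kernels `g_{i_1,…,i_c}`, with respect to independent random variables `ξ_1,…,ξ_n`
with distributions `μ_1,…,μ_n` (whose joint law is `Measure.pi μ`). -/
def IsKernelSystem {n : ℕ} (μ : Fin n → Measure ℝ) (g : Finset (Fin n) → (Fin n → ℝ) → ℝ) :
    Prop :=
  (∀ S : Finset (Fin n), 2 ≤ S.card →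
      Measurable (g S) ∧ DependsOnlyOn S (g S) ∧
      Integrable (g S) (Measure.pi μ) ∧
      ∀ k ∈ S, ∀ᵐ x ∂Measure.pi μ, ∫ t, g S (Function.update x k t) ∂μ k = 0) ∧
  (∀ᵐ x ∂Measure.pi μ, -1 ≤ Usum g x)

/-- The measurable cylinder of points whose coordinates in `S` lie in the sets `A i`. -/
def cylinderBox {n : ℕ} (S : Finset (Fin n)) (A : Fin n → Set ℝ) : Set (Fin n → ℝ) :=
  {x | ∀ i ∈ S, x i ∈ A i}

/-- The kernels extended to all index sets: the kernel of the empty set is `1`. -/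
def extKernel {n : ℕ} (g : Finset (Fin n) → (Fin n → ℝ) → ℝ) (S : Finset (Fin n)) :
    (Fin n → ℝ) → ℝ :=
  if S = ∅ then 1 else g S

/-- The density of the marginal on the coordinates in `S`. -/
noncomputable def marginalDensity {n : ℕ} (g : Finset (Fin n) → (Fin n → ℝ) → ℝ)
    (S : Finset (Fin n)) (x : Fin n → ℝ) : ℝ :=
  ∑ B ∈ S.powerset, extKernel g B x

section Combinatorics

variable {α : Type*} [DecidableEq α]

theorem sum_powerset_union_of_disjoint {S T : Finset α} (h : Disjoint S T)
    (f : Finset α → ℝ) :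
    ∑ B ∈ (S ∪ T).powerset, f B = ∑ P ∈ S.powerset, ∑ Q ∈ T.powerset, f (P ∪ Q) := by
  rw [← Finset.sum_product']
  symm
  refine Finset.sum_bij' (fun p _ => p.1 ∪ p.2) (fun B _ => (B ∩ S, B ∩ T)) ?_ ?_ ?_ ?_ ?_
  · rintro ⟨P, Q⟩ hp
    simp only [mem_product, mem_powerset] at hp ⊢
    exact Finset.union_subset_union hp.1 hp.2
  · intro B _
    simp
  · rintro ⟨P, Q⟩ hp
    simp only [mem_product, mem_powerset] at hp
    have h1 : Disjoint Q S := (h.mono_right hp.2).symm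
    have h2 : Disjoint P T := h.mono_left hp.1
    simp only [Finset.union_inter_distrib_right, Finset.inter_eq_left.2 hp.1,
      Finset.inter_eq_left.2 hp.2, Finset.disjoint_iff_inter_eq_empty.1 h1,
      Finset.disjoint_iff_inter_eq_empty.1 h2, Finset.union_empty, Finset.empty_union]
  · intro B hB
    rw [mem_powerset] at hB
    simp only [← Finset.inter_union_distrib_left]
    exact Finset.inter_eq_left.2 hB
  · intro p _
    rfl

theorem eq_zero_of_sum_powerset_eq_zero {f : Finset α → ℝ} (S : Finset α)
    (h : ∀ P ⊆ S, ∑ B ∈ P.powerset, f B = 0) : f S = 0 := by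
  induction S using Finset.strongInduction with
  | H S ih =>
    have hS := h S subset_rfl
    rw [← Finset.sum_erase_add _ _ (Finset.mem_powerset_self S), Finset.sum_eq_zero,
      zero_add] at hS
    · exact hS
    · intro B hB
      rw [mem_erase, mem_powerset] at hB
      exact ih B (Finset.ssubset_iff_subset_ne.2 ⟨hB.2, hB.1⟩)
        fun P hP => h P (hP.trans hB.2)

theorem eq_zero_of_sum_powerset_sum_powerset_eq_zero {f : Finset α → Finset α → ℝ}
    (S T : Finset α)
    (h : ∀ P ⊆ S, ∀ Q ⊆ T, ∑ B ∈ P.powerset, ∑ C ∈ Q.powerset, f B C = 0) : f S T = 0 := by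
  refine eq_zero_of_sum_powerset_eq_zero (f := fun B => f B T) S fun P hP => ?_
  refine eq_zero_of_sum_powerset_eq_zero (f := fun C => ∑ B ∈ P.powerset, f B C) T
    fun Q hQ => ?_
  rw [Finset.sum_comm]
  exact h P hP Q hQ

end Combinatorics

section DependsOnlyOn

variable {n : ℕ} {S T : Finset (Fin n)} {f f' : (Fin n → ℝ) → ℝ}

theorem DependsOnlyOn.mono (hf : DependsOnlyOn S f) (h : S ⊆ T) : DependsOnlyOn T f :=
  fun x y hxy => hf x y fun i hi => hxy i (h hi)

theorem DependsOnlyOn.indicator_cylinderBox (hf : DependsOnlyOn S f) (A : Fin n → Set ℝ) :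
    DependsOnlyOn S ((cylinderBox S A).indicator f) := by
  intro x y hxy
  have : x ∈ cylinderBox S A ↔ y ∈ cylinderBox S A :=
    forall₂_congr fun i hi => by rw [hxy i hi]
  by_cases hx : x ∈ cylinderBox S A
  · rw [Set.indicator_of_mem hx, Set.indicator_of_mem (this.1 hx), hf x y hxy]
  · rw [Set.indicator_of_notMem hx, Set.indicator_of_notMem (mt this.2 hx)]

theorem measurableSet_cylinderBox {A : Fin n → Set ℝ} (hA : ∀ i, MeasurableSet (A i)) :
    MeasurableSet (cylinderBox S A) := by
  have : cylinderBox S A = ⋂ i ∈ S, (fun x : Fin n → ℝ => x i) ⁻¹' A i := by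
    ext x; simp [cylinderBox]
  rw [this]
  exact Finset.measurableSet_biInter _ fun i _ => measurable_pi_apply i (hA i)

theorem cylinderBox_union (A : Fin n → Set ℝ) :
    cylinderBox (S ∪ T) A = cylinderBox S A ∩ cylinderBox T A := by
  ext x
  simp only [cylinderBox, Finset.mem_union, or_imp, forall_and, Set.mem_ofPred_eq,
    Set.mem_inter_iff]

end DependsOnlyOn

section Product

variable {n : ℕ} {μ : Fin n → Measure ℝ} [∀ i, IsProbabilityMeasure (μ i)]
  {S T : Finset (Fin n)} {f f' : (Fin n → ℝ) → ℝ}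

theorem DependsOnlyOn.indepFun (hf : DependsOnlyOn S f) (hf' : DependsOnlyOn T f')
    (hm : Measurable f) (hm' : Measurable f') (h : Disjoint S T) :
    ProbabilityTheory.IndepFun f f' (Measure.pi μ) := by
  have key := (ProbabilityTheory.iIndepFun_pi (μ := μ) (X := fun _ => (id : ℝ → ℝ))
    fun _ => aemeasurable_id).indepFun_finset S T h fun i => measurable_pi_apply i
  have ext_meas : ∀ U : Finset (Fin n), Measurable
      (fun (y : U → ℝ) (i : Fin n) => if hi : i ∈ U then y ⟨i, hi⟩ else 0) := by
    intro U
    refine measurable_pi_lambda _ fun i => ?_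
    by_cases hi : i ∈ U
    · simpa [hi] using measurable_pi_apply _
    · simp [hi]
  convert key.comp (hm.comp (ext_meas S)) (hm'.comp (ext_meas T)) using 1
  · funext x
    exact hf _ _ fun i hi => by simp [hi]
  · funext x
    exact hf' _ _ fun i hi => by simp [hi]

theorem DependsOnlyOn.setIntegral_cylinderBox_union (hf : DependsOnlyOn S f)
    (hf' : DependsOnlyOn T f') (hm : Measurable f) (hm' : Measurable f') (h : Disjoint S T)
    {A : Fin n → Set ℝ} (hA : ∀ i, MeasurableSet (A i)) :
    ∫ x in cylinderBox (S ∪ T) A, f x * f' x ∂Measure.pi μ =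
      (∫ x in cylinderBox S A, f x ∂Measure.pi μ) *
        ∫ x in cylinderBox T A, f' x ∂Measure.pi μ := by
  have mS := measurableSet_cylinderBox (S := S) hA
  have mT := measurableSet_cylinderBox (S := T) hA
  rw [← integral_indicator (measurableSet_cylinderBox hA), ← integral_indicator mS,
    ← integral_indicator mT,
    ← ((hf.indicator_cylinderBox A).indepFun (hf'.indicator_cylinderBox A) (hm.indicator mS)
      (hm'.indicator mT) h).integral_fun_mul_eq_mul_integral
      (hm.indicator mS).aestronglyMeasurable (hm'.indicator mT).aestronglyMeasurable]
  refine integral_congr_ae (Filter.Eventually.of_forall fun x => ?_)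
  simp only [cylinderBox_union]
  exact Set.inter_indicator_mul f f' x

theorem DependsOnlyOn.ae_eq_zero (hf : DependsOnlyOn S f) (hm : Measurable f)
    (hi : Integrable f (Measure.pi μ))
    (h : ∀ A : Fin n → Set ℝ, (∀ i, MeasurableSet (A i)) →
      ∫ x in cylinderBox S A, f x ∂Measure.pi μ = 0) :
    f =ᵐ[Measure.pi μ] 0 := by
  have box : ∀ A : Fin n → Set ℝ, (∀ i, MeasurableSet (A i)) →
      ∫ x in Set.univ.pi A, f x ∂Measure.pi μ = 0 := by
    intro A hA
    have key := hf.setIntegral_cylinderBox_union (μ := μ) (T := Sᶜ) (f' := fun _ => 1)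
      (fun _ _ _ => rfl) hm measurable_const disjoint_compl_right hA
    have hU : cylinderBox (S ∪ Sᶜ) A = Set.univ.pi A := by
      ext x; simp [cylinderBox]
    rw [h A hA, zero_mul, hU] at key
    simpa using key
  refine hi.ae_eq_zero_of_forall_setIntegral_eq_zero fun s hs _ => ?_
  induction s, hs using MeasurableSpace.induction_on_inter
    (generateFrom_pi (α := fun _ : Fin n => ℝ)).symm isPiSystem_pi with
  | empty => simp
  | basic t ht =>
    obtain ⟨A, hA, rfl⟩ := ht
    exact box A fun i => hA i (Set.mem_univ i)
  | compl t ht ih =>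
    have hu : ∫ x, f x ∂Measure.pi μ = 0 := by
      simpa using box (fun _ => Set.univ) fun _ => MeasurableSet.univ
    have := integral_add_compl ht hi
    rw [ih (measure_lt_top _ _), zero_add, hu] at this
    exact this
  | iUnion t hd ht ih =>
    rw [integral_iUnion ht hd hi.integrableOn]
    simp [ih]

theorem measurePreserving_update (k : Fin n) :
    MeasurePreserving (fun p : (Fin n → ℝ) × ℝ => Function.update p.1 k p.2)
      ((Measure.pi μ).prod (μ k)) (Measure.pi μ) := by
  refine ⟨measurable_update', ?_⟩
  symm
  refine Measure.pi_eq fun s hs => ?_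
  rw [Measure.map_apply measurable_update' (MeasurableSet.univ_pi hs)]
  have : (fun p : (Fin n → ℝ) × ℝ => Function.update p.1 k p.2) ⁻¹' Set.univ.pi s =
      (Set.univ.pi (Function.update s k Set.univ)) ×ˢ s k := by
    ext ⟨x, t⟩
    simp only [Set.mem_preimage, Set.mem_pi, Set.mem_univ, true_imp_iff, Set.mem_prod]
    constructor
    · intro H
      refine ⟨fun i => ?_, by simpa using H k⟩
      by_cases hik : i = k
      · subst hik; simp
      · simpa [hik] using H i
    · rintro ⟨H, ht⟩ i
      by_cases hik : i = k
      · subst hik; simpa using ht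
      · simpa [hik] using H i
  rw [this, Measure.prod_prod, Measure.pi_pi, ← Finset.prod_erase_mul _ _ (Finset.mem_univ k),
    ← Finset.prod_erase_mul univ (fun i => μ i (s i)) (Finset.mem_univ k)]
  congr 1
  rw [Function.update_self, measure_univ, mul_one]
  refine Finset.prod_congr rfl fun i hi => ?_
  rw [Function.update_of_ne (Finset.ne_of_mem_erase hi)]

theorem setIntegral_cylinderBox_eq_zero_of_degenerate {k : Fin n} (hk : k ∉ S)
    (hi : Integrable f (Measure.pi μ))
    (hdeg : ∀ᵐ x ∂Measure.pi μ, ∫ t, f (Function.update x k t) ∂μ k = 0)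
    {A : Fin n → Set ℝ} (hA : ∀ i, MeasurableSet (A i)) :
    ∫ x in cylinderBox S A, f x ∂Measure.pi μ = 0 := by
  have mS := measurableSet_cylinderBox (S := S) hA
  have hmp := measurePreserving_update (μ := μ) k
  have hI : Integrable ((cylinderBox S A).indicator f) (Measure.pi μ) := hi.indicator mS
  have hI' : Integrable (fun p : (Fin n → ℝ) × ℝ =>
      (cylinderBox S A).indicator f (Function.update p.1 k p.2))
      ((Measure.pi μ).prod (μ k)) :=
    hmp.integrable_comp_of_integrable hI
  rw [← integral_indicator mS]
  nth_rewrite 1 [← hmp.map_eq]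
  rw [integral_map hmp.measurable.aemeasurable
    (by rw [hmp.map_eq]; exact hI.aestronglyMeasurable), integral_prod _ hI']
  refine integral_eq_zero_of_ae ?_
  filter_upwards [hdeg] with x hx
  have hmem : ∀ t, Function.update x k t ∈ cylinderBox S A ↔ x ∈ cylinderBox S A := fun t =>
    forall₂_congr fun i hiS => by
      rw [Function.update_of_ne (fun h : i = k => hk (h ▸ hiS))]
  by_cases hxS : x ∈ cylinderBox S A
  · simpa [Set.indicator, hmem, hxS] using hx
  · simp [Set.indicator, hmem, hxS]

end Product

section Kernel

variable {n : ℕ} {μ : Fin n → Measure ℝ} [∀ i, IsProbabilityMeasure (μ i)]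
  {g : Finset (Fin n) → (Fin n → ℝ) → ℝ}

theorem extKernel_of_nonempty {S : Finset (Fin n)} (hS : S.Nonempty) : extKernel g S = g S :=
  if_neg hS.ne_empty

@[simp]
theorem extKernel_empty : extKernel g ∅ = 1 := if_pos rfl

theorem extKernel_properties (hg : IsKernelSystem μ g)
    (hg0 : ∀ S : Finset (Fin n), S.card < 2 → g S = 0) (S : Finset (Fin n)) :
    Measurable (extKernel g S) ∧ DependsOnlyOn S (extKernel g S) ∧
      Integrable (extKernel g S) (Measure.pi μ) ∧
      ∀ k ∈ S, ∀ᵐ x ∂Measure.pi μ, ∫ t, extKernel g S (Function.update x k t) ∂μ k = 0 := by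
  rcases S.eq_empty_or_nonempty with rfl | hS
  · rw [extKernel_empty]
    exact ⟨measurable_one, fun _ _ _ => rfl, integrable_const 1, by simp⟩
  · rw [extKernel_of_nonempty hS]
    by_cases hc : 2 ≤ S.card
    · exact hg.1 S hc
    · rw [hg0 S (not_le.1 hc)]
      exact ⟨measurable_zero, fun _ _ _ => rfl, integrable_zero _ _ _, by simp⟩

theorem one_add_Usum (hg0 : ∀ S : Finset (Fin n), S.card < 2 → g S = 0) (x : Fin n → ℝ) :
    1 + Usum g x = ∑ B : Finset (Fin n), extKernel g B x := by
  rw [← Finset.add_sum_erase _ _ (Finset.mem_univ ∅), Usum, extKernel_empty, Pi.one_apply]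
  congr 1
  have h : ∀ B ∈ univ.erase (∅ : Finset (Fin n)), extKernel g B x = g B x := fun B hB => by
    rw [extKernel_of_nonempty (Finset.nonempty_iff_ne_empty.2 (Finset.ne_of_mem_erase hB))]
  rw [Finset.sum_congr rfl h]
  refine Finset.sum_subset (fun B hB => ?_) fun B _ hB => ?_
  · refine Finset.mem_erase.2 ⟨?_, Finset.mem_univ _⟩
    rintro rfl
    simp at hB
  · rw [hg0 B (by simpa using hB), Pi.zero_apply]

theorem measurable_marginalDensity (hg : IsKernelSystem μ g)
    (hg0 : ∀ S : Finset (Fin n), S.card < 2 → g S = 0) (S : Finset (Fin n)) :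
    Measurable (marginalDensity g S) :=
  Finset.measurable_fun_sum _ fun B _ => (extKernel_properties hg hg0 B).1

theorem integrable_marginalDensity (hg : IsKernelSystem μ g)
    (hg0 : ∀ S : Finset (Fin n), S.card < 2 → g S = 0) (S : Finset (Fin n)) :
    Integrable (marginalDensity g S) (Measure.pi μ) :=
  integrable_finsetSum _ fun B _ => (extKernel_properties hg hg0 B).2.2.1

theorem dependsOnlyOn_marginalDensity (hg : IsKernelSystem μ g)
    (hg0 : ∀ S : Finset (Fin n), S.card < 2 → g S = 0) (S : Finset (Fin n)) :
    DependsOnlyOn S (marginalDensity g S) := fun x y hxy =>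
  Finset.sum_congr rfl fun B hB =>
    ((extKernel_properties hg hg0 B).2.1.mono (Finset.mem_powerset.1 hB)) x y hxy

@[simp]
theorem marginalDensity_empty (x : Fin n → ℝ) : marginalDensity g ∅ x = 1 := by
  simp [marginalDensity]

theorem setIntegral_cylinderBox_one_add_Usum (hg : IsKernelSystem μ g)
    (hg0 : ∀ S : Finset (Fin n), S.card < 2 → g S = 0) (S : Finset (Fin n))
    {A : Fin n → Set ℝ} (hA : ∀ i, MeasurableSet (A i)) :
    ∫ x in cylinderBox S A, (1 + Usum g x) ∂Measure.pi μ =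
      ∫ x in cylinderBox S A, marginalDensity g S x ∂Measure.pi μ := by
  have hint : ∀ B, Integrable (extKernel g B) ((Measure.pi μ).restrict (cylinderBox S A)) :=
    fun B => (extKernel_properties hg hg0 B).2.2.1.restrict
  simp only [one_add_Usum hg0, marginalDensity]
  rw [integral_finsetSum _ fun B _ => hint B, integral_finsetSum _ fun B _ => hint B]
  symm
  refine Finset.sum_subset (Finset.subset_univ _) fun B _ hB => ?_
  rw [Finset.mem_powerset, Finset.not_subset] at hB
  obtain ⟨k, hkB, hkS⟩ := hB
  obtain ⟨-, -, hi, hdeg⟩ := extKernel_properties hg hg0 B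
  exact setIntegral_cylinderBox_eq_zero_of_degenerate hkS hi (hdeg k hkB) hA

theorem withDensity_cylinderBox (hg : IsKernelSystem μ g)
    (hg0 : ∀ S : Finset (Fin n), S.card < 2 → g S = 0) (S : Finset (Fin n))
    {A : Fin n → Set ℝ} (hA : ∀ i, MeasurableSet (A i)) :
    (Measure.pi μ).withDensity (fun x => ENNReal.ofReal (1 + Usum g x)) (cylinderBox S A) =
        ENNReal.ofReal (∫ x in cylinderBox S A, marginalDensity g S x ∂Measure.pi μ) ∧
      0 ≤ ∫ x in cylinderBox S A, marginalDensity g S x ∂Measure.pi μ := by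
  have hnn : 0 ≤ᵐ[(Measure.pi μ).restrict (cylinderBox S A)] fun x => 1 + Usum g x := by
    refine ae_restrict_of_ae ?_
    filter_upwards [hg.2] with x hx
    simp only [Pi.zero_apply]
    linarith
  have hint : Integrable (fun x => 1 + Usum g x) (Measure.pi μ) := by
    simp only [one_add_Usum hg0]
    exact integrable_finsetSum _ fun B _ => (extKernel_properties hg hg0 B).2.2.1
  rw [← setIntegral_cylinderBox_one_add_Usum hg hg0 S hA]
  refine ⟨?_, integral_nonneg_of_ae hnn⟩
  rw [withDensity_apply _ (measurableSet_cylinderBox hA),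
    ofReal_integral_eq_lintegral_ofReal hint.restrict hnn]

theorem withDensity_cylinderBox_union_iff (hg : IsKernelSystem μ g)
    (hg0 : ∀ S : Finset (Fin n), S.card < 2 → g S = 0) {S T : Finset (Fin n)}
    (hST : Disjoint S T) {A : Fin n → Set ℝ} (hA : ∀ i, MeasurableSet (A i))
    {ν : Measure (Fin n → ℝ)}
    (hrep : ν = (Measure.pi μ).withDensity fun x => ENNReal.ofReal (1 + Usum g x)) :
    ν (cylinderBox (S ∪ T) A) = ν (cylinderBox S A) * ν (cylinderBox T A) ↔
      ∫ x in cylinderBox (S ∪ T) A, marginalDensity g (S ∪ T) x ∂Measure.pi μ =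
        ∫ x in cylinderBox (S ∪ T) A, marginalDensity g S x * marginalDensity g T x
          ∂Measure.pi μ := by
  obtain ⟨hU, hU0⟩ := withDensity_cylinderBox hg hg0 (S ∪ T) hA
  obtain ⟨hS, hS0⟩ := withDensity_cylinderBox hg hg0 S hA
  obtain ⟨hT, hT0⟩ := withDensity_cylinderBox hg hg0 T hA
  rw [hrep, hU, hS, hT, ← ENNReal.ofReal_mul hS0,
    ENNReal.ofReal_eq_ofReal_iff hU0 (mul_nonneg hS0 hT0),
    (dependsOnlyOn_marginalDensity hg hg0 S).setIntegral_cylinderBox_union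
      (dependsOnlyOn_marginalDensity hg hg0 T) (measurable_marginalDensity hg hg0 S)
      (measurable_marginalDensity hg hg0 T) hST hA]

theorem marginalDensity_union_ae_eq (hg : IsKernelSystem μ g)
    (hg0 : ∀ S : Finset (Fin n), S.card < 2 → g S = 0) {S T : Finset (Fin n)}
    (hST : Disjoint S T)
    (h : ∀ A : Fin n → Set ℝ, (∀ i, MeasurableSet (A i)) →
      ∫ x in cylinderBox (S ∪ T) A, marginalDensity g (S ∪ T) x ∂Measure.pi μ =
        ∫ x in cylinderBox (S ∪ T) A, marginalDensity g S x * marginalDensity g T x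
          ∂Measure.pi μ) :
    ∀ᵐ x ∂Measure.pi μ,
      marginalDensity g (S ∪ T) x = marginalDensity g S x * marginalDensity g T x := by
  have mS := measurable_marginalDensity hg hg0 S
  have mT := measurable_marginalDensity hg hg0 T
  have mU := measurable_marginalDensity hg hg0 (S ∪ T)
  have dS := dependsOnlyOn_marginalDensity hg hg0 S
  have dT := dependsOnlyOn_marginalDensity hg hg0 T
  have dU := dependsOnlyOn_marginalDensity hg hg0 (S ∪ T)
  have iU := integrable_marginalDensity hg hg0 (S ∪ T)
  have iST : Integrable (fun x => marginalDensity g S x * marginalDensity g T x)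
      (Measure.pi μ) :=
    (dS.indepFun dT mS mT hST).integrable_mul (integrable_marginalDensity hg hg0 S)
      (integrable_marginalDensity hg hg0 T)
  have key := DependsOnlyOn.ae_eq_zero (μ := μ) (S := S ∪ T)
    (f := fun x => marginalDensity g (S ∪ T) x - marginalDensity g S x * marginalDensity g T x)
    (fun x y hxy => by
      simp only [dU x y hxy, dS.mono Finset.subset_union_left x y hxy,
        dT.mono Finset.subset_union_right x y hxy])
    (mU.sub (mS.mul mT)) (iU.sub iST)
    fun A hA => by rw [integral_sub iU.restrict iST.restrict, h A hA, sub_self]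
  filter_upwards [key] with x hx
  exact sub_eq_zero.1 hx

theorem marginalDensity_union_sub (g : Finset (Fin n) → (Fin n → ℝ) → ℝ)
    {S T : Finset (Fin n)} (hST : Disjoint S T) (x : Fin n → ℝ) :
    marginalDensity g (S ∪ T) x - marginalDensity g S x * marginalDensity g T x =
      ∑ P ∈ S.powerset, ∑ Q ∈ T.powerset,
        (extKernel g (P ∪ Q) x - extKernel g P x * extKernel g Q x) := by
  simp only [marginalDensity, Finset.sum_sub_distrib]
  rw [sum_powerset_union_of_disjoint hST (fun B => extKernel g B x), Finset.sum_mul_sum]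

end Kernel

/-- Theorem 5.6: random variables `X₁,…,Xₙ` whose joint law `ν` has the canonical
representation with kernels `g` satisfying A1–A3 (with the convention that kernels indexed
by fewer than two indices vanish) are `m`-dependent (any two vectors of the `X`'s whose index
groups are separated by a gap of at least `m` are independent) if and only if the kernels
factorize across every gap of length at least `m`:
`g_{i₁,…,i_k,i_{k+1},…,i_c} = g_{i₁,…,i_k} ⋅ g_{i_{k+1},…,i_c}` whenever
`i_{k+1} - i_k ≥ m`. Independence of the two coordinate vectors is expressed via product
formulas on measurable rectangles. -/
theorem statement9 (n m : ℕ) (hm : 1 ≤ m) (hmn : m ≤ n)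
    (μ : Fin n → Measure ℝ) [∀ i, IsProbabilityMeasure (μ i)]
    (g : Finset (Fin n) → (Fin n → ℝ) → ℝ) (hg : IsKernelSystem μ g)
    (hg0 : ∀ S : Finset (Fin n), S.card < 2 → g S = 0)
    (ν : Measure (Fin n → ℝ))
    (hrep : ν = (Measure.pi μ).withDensity fun x => ENNReal.ofReal (1 + Usum g x)) :
    (∀ S T : Finset (Fin n), S.Nonempty → T.Nonempty →
        (∀ i ∈ S, ∀ j ∈ T, (i : ℕ) + m ≤ (j : ℕ)) →
        ∀ A : Fin n → Set ℝ, (∀ i, MeasurableSet (A i)) →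
          ν {x | ∀ i ∈ S ∪ T, x i ∈ A i} =
            ν {x | ∀ i ∈ S, x i ∈ A i} * ν {x | ∀ i ∈ T, x i ∈ A i}) ↔
      (∀ S T : Finset (Fin n), S.Nonempty → T.Nonempty →
        (∀ i ∈ S, ∀ j ∈ T, (i : ℕ) + m ≤ (j : ℕ)) →
        g (S ∪ T) =ᵐ[Measure.pi μ] fun x => g S x * g T x) := by
  have hdisj : ∀ S T : Finset (Fin n), (∀ i ∈ S, ∀ j ∈ T, (i : ℕ) + m ≤ (j : ℕ)) →
      Disjoint S T := fun S T h => Finset.disjoint_left.2 fun i hS hT => by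
    have := h i hS i hT
    omega
  constructor
  · intro hdep S T hS hT hgap
    have hae : ∀ᵐ x ∂Measure.pi μ, ∀ P Q : Finset (Fin n), P ⊆ S → Q ⊆ T →
        marginalDensity g (P ∪ Q) x = marginalDensity g P x * marginalDensity g Q x := by
      refine ae_all_iff.2 fun P => ae_all_iff.2 fun Q => ?_
      by_cases hPQ : P ⊆ S ∧ Q ⊆ T
      · suffices ∀ᵐ x ∂Measure.pi μ,
            marginalDensity g (P ∪ Q) x = marginalDensity g P x * marginalDensity g Q x by
          filter_upwards [this] with x hx _ _ using hx
        rcases P.eq_empty_or_nonempty with rfl | hP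
        · simp
        rcases Q.eq_empty_or_nonempty with rfl | hQ
        · simp
        have hgap' : ∀ i ∈ P, ∀ j ∈ Q, (i : ℕ) + m ≤ (j : ℕ) :=
          fun i hi j hj => hgap i (hPQ.1 hi) j (hPQ.2 hj)
        exact marginalDensity_union_ae_eq hg hg0 (hdisj P Q hgap') fun A hA =>
          (withDensity_cylinderBox_union_iff hg hg0 (hdisj P Q hgap') hA hrep).1
            (hdep P Q hP hQ hgap' A hA)
      · exact Filter.Eventually.of_forall fun x h1 h2 => absurd ⟨h1, h2⟩ hPQ
    filter_upwards [hae] with x hx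
    have key := eq_zero_of_sum_powerset_sum_powerset_eq_zero
      (f := fun P Q => extKernel g (P ∪ Q) x - extKernel g P x * extKernel g Q x) S T
      fun P hP Q hQ => by
        rw [← marginalDensity_union_sub g ((hdisj S T hgap).mono hP hQ) x, hx P Q hP hQ, sub_self]
    rw [extKernel_of_nonempty hS, extKernel_of_nonempty hT,
      extKernel_of_nonempty (hS.mono Finset.subset_union_left)] at key
    exact sub_eq_zero.1 key
  · intro hfac S T _ _ hgap A hA
    refine (withDensity_cylinderBox_union_iff hg hg0 (hdisj S T hgap) hA hrep).2 ?_
    have hae : ∀ᵐ x ∂Measure.pi μ, ∀ P Q : Finset (Fin n), P ⊆ S → Q ⊆ T →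
        extKernel g (P ∪ Q) x = extKernel g P x * extKernel g Q x := by
      refine ae_all_iff.2 fun P => ae_all_iff.2 fun Q => ?_
      rcases P.eq_empty_or_nonempty with rfl | hP
      · simp
      rcases Q.eq_empty_or_nonempty with rfl | hQ
      · simp
      by_cases hPQ : P ⊆ S ∧ Q ⊆ T
      · filter_upwards [hfac P Q hP hQ fun i hi j hj => hgap i (hPQ.1 hi) j (hPQ.2 hj)]
          with x hx _ _
        rw [extKernel_of_nonempty hP, extKernel_of_nonempty hQ,
          extKernel_of_nonempty (hP.mono Finset.subset_union_left), hx]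
      · exact Filter.Eventually.of_forall fun x h1 h2 => absurd ⟨h1, h2⟩ hPQ
    refine integral_congr_ae (ae_restrict_of_ae ?_)
    filter_upwards [hae] with x hx
    rw [← sub_eq_zero, marginalDensity_union_sub g (hdisj S T hgap) x]
    refine Finset.sum_eq_zero fun P hP => Finset.sum_eq_zero fun Q hQ => ?_
    rw [hx P Q (Finset.mem_powerset.1 hP) (Finset.mem_powerset.1 hQ), sub_self]
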